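/- Let A be a strictly full additive subcategory of an additive category B such that every object of B is a direct summand of an object of A. Regarding F(A) as a subgroup of F(B) via the natural embedding, one has E(B) ∩ F(A) = E(A). -/

import Mathlib

/- STATEMENT 14: Let A be a strictly full additive subcategory of an additive
category B such that every object of B is a direct summand of an object of A.
Regarding F(A) (the free abelian group on isomorphism classes of objects of A)
as a subgroup of F(B), one has E(B) ∩ F(A) = E(A), where E(-) is the subgroup
generated by the elements [X ⊕ Y] − [X] − [Y]. -/

open CategoryTheory Limits

universe v u

variable {B : Type u} [Category.{v} B] [Preadditive B] [HasZeroObject B]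
  [HasFiniteBiproducts B]

/-- `Y` is a direct sum of `X` and `Z`. -/
def IsDirectSumOf (Y X Z : B) : Prop :=
  ∃ (i : X ⟶ Y) (j : Z ⟶ Y) (p : Y ⟶ X) (q : Y ⟶ Z),
    i ≫ p = 𝟙 X ∧ j ≫ q = 𝟙 Z ∧ i ≫ q = 0 ∧ j ≫ p = 0 ∧ p ≫ i + q ≫ j = 𝟙 Y

/-- `X` is a direct summand of `Y`. -/
def IsSummand (X Y : B) : Prop := ∃ Z : B, IsDirectSumOf Y X Z

/-- the class `[X]` of an object: its isomorphism class, viewed as a generator of the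
free abelian group `F(B)` on the isomorphism classes of objects of `B`. -/
def fo (X : B) : FreeAbelianGroup (Quotient (isIsomorphicSetoid B)) :=
  FreeAbelianGroup.of (Quotient.mk (isIsomorphicSetoid B) X)

/-- the subgroup of `F(B)` generated by the classes of objects of `S`; for a strictly
full subcategory `S` this is the image of `F(A) → F(B)`. -/
def FSub (S : Set B) : AddSubgroup (FreeAbelianGroup (Quotient (isIsomorphicSetoid B))) :=
  AddSubgroup.closure {x | ∃ X ∈ S, x = fo X}

/-- the subgroup `E(A) ⊆ F(B)` generated by the elements `[X ⊕ Z] − [X] − [Z]` for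
`X, Z` objects of `S`. -/
def ESub (S : Set B) : AddSubgroup (FreeAbelianGroup (Quotient (isIsomorphicSetoid B))) :=
  AddSubgroup.closure
    {x | ∃ X Z Y : B, X ∈ S ∧ Z ∈ S ∧ Y ∈ S ∧ IsDirectSumOf Y X Z ∧
      x = fo Y - fo X - fo Z}

section

open scoped ZeroObject

variable {C : Type u} [Category.{v} C]

/-- The isomorphism class of an object. -/
def isoClass (X : C) : Quotient (isIsomorphicSetoid C) := Quotient.mk _ X

theorem fo_eq_of_isoClass (X : C) : fo X = FreeAbelianGroup.of (isoClass X) := rfl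

variable [Preadditive C]

theorem ESub_mono {S T : Set C} (h : S ⊆ T) : ESub S ≤ ESub T := by
  refine AddSubgroup.closure_mono ?_
  rintro _ ⟨X, Z, Y, hX, hZ, hY, hd, rfl⟩
  exact ⟨X, Z, Y, h hX, h hZ, h hY, hd, rfl⟩

theorem ESub_le_FSub (S : Set C) : ESub S ≤ FSub S := by
  refine (AddSubgroup.closure_le _).2 ?_
  rintro _ ⟨X, Z, Y, hX, hZ, hY, -, rfl⟩
  have hfo : ∀ W ∈ S, fo W ∈ FSub S := fun W hW => AddSubgroup.subset_closure ⟨W, hW, rfl⟩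
  exact sub_mem (sub_mem (hfo Y hY) (hfo X hX)) (hfo Z hZ)

theorem fo_mem_ESub_of_isZero {S : Set C} {Z : C} (hZ : IsZero Z) (hZS : Z ∈ S) :
    fo Z ∈ ESub S := by
  have h : fo Z - fo Z - fo Z ∈ ESub S := AddSubgroup.subset_closure
    ⟨Z, Z, Z, hZS, hZS, hZS, ⟨0, 0, 0, 0, hZ.eq_of_src _ _, hZ.eq_of_src _ _,
      hZ.eq_of_src _ _, hZ.eq_of_src _ _, hZ.eq_of_src _ _⟩, rfl⟩
  simpa using h

variable [HasBinaryBiproducts C]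

theorem IsDirectSumOf.nonempty_iso {Y X Z : C} (h : IsDirectSumOf Y X Z) :
    Nonempty (Y ≅ X ⊞ Z) := by
  obtain ⟨i, j, p, q, hip, hjq, hiq, hjp, htot⟩ := h
  exact ⟨{
    hom := biprod.lift p q
    inv := biprod.desc i j
    hom_inv_id := by rw [biprod.lift_desc, htot]
    inv_hom_id := by ext <;> simp [hip, hjq, hiq, hjp] }⟩

theorem isDirectSumOf_biprod (X Z : C) : IsDirectSumOf (X ⊞ Z) X Z :=
  ⟨biprod.inl, biprod.inr, biprod.fst, biprod.snd, by simp, by simp, by simp, by simp,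
    biprod.total⟩

theorem fo_biprod_sub_mem_ESub {S : Set C}
    (hsum : ∀ ⦃X Z Y : C⦄, IsDirectSumOf Y X Z → X ∈ S → Z ∈ S → Y ∈ S)
    {X Z : C} (hX : X ∈ S) (hZ : Z ∈ S) : fo (X ⊞ Z) - fo X - fo Z ∈ ESub S :=
  AddSubgroup.subset_closure ⟨X, Z, X ⊞ Z, hX, hZ, hsum (isDirectSumOf_biprod X Z) hX hZ,
    isDirectSumOf_biprod X Z, rfl⟩

/-- Every element of `FSub S` is a difference of two classes of objects of `S` modulo `ESub S`. -/
theorem exists_sub_mem_ESub {S : Set C} (hzero : ∃ Z : C, IsZero Z ∧ Z ∈ S)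
    (hsum : ∀ ⦃X Z Y : C⦄, IsDirectSumOf Y X Z → X ∈ S → Z ∈ S → Y ∈ S)
    {x : FreeAbelianGroup (Quotient (isIsomorphicSetoid C))} (hx : x ∈ FSub S) :
    ∃ X ∈ S, ∃ Y ∈ S, x - (fo X - fo Y) ∈ ESub S := by
  obtain ⟨O, hO, hOS⟩ := hzero
  have hO' := fo_mem_ESub_of_isZero hO hOS
  induction hx using AddSubgroup.closure_induction with
  | mem x hx =>
    obtain ⟨X, hX, rfl⟩ := hx
    exact ⟨X, hX, O, hOS, by simpa using hO'⟩
  | zero => exact ⟨O, hOS, O, hOS, by simp⟩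
  | add x y _ _ hx hy =>
    obtain ⟨X, hX, Y, hY, hxy⟩ := hx
    obtain ⟨X', hX', Y', hY', hxy'⟩ := hy
    refine ⟨X ⊞ X', hsum (isDirectSumOf_biprod _ _) hX hX', Y ⊞ Y',
      hsum (isDirectSumOf_biprod _ _) hY hY', ?_⟩
    convert sub_mem (add_mem (add_mem hxy hxy') (fo_biprod_sub_mem_ESub hsum hY hY'))
      (fo_biprod_sub_mem_ESub hsum hX hX') using 1
    abel
  | neg x _ hx =>
    obtain ⟨X, hX, Y, hY, hxy⟩ := hx
    refine ⟨Y, hY, X, hX, ?_⟩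
    convert neg_mem hxy using 1
    abel

/-- Isomorphism classes of objects are added by direct sum. -/
noncomputable instance isoClassAdd : Add (Quotient (isIsomorphicSetoid C)) where
  add := Quotient.map₂ (fun X Y => X ⊞ Y)
    fun _ _ ⟨e⟩ _ _ ⟨f⟩ => ⟨biprod.mapIso e f⟩

theorem isoClass_biprod (X Y : C) : isoClass (X ⊞ Y) = isoClass X + isoClass Y := rfl

theorem IsDirectSumOf.isoClass_eq {Y X Z : C} (h : IsDirectSumOf Y X Z) :
    isoClass Y = isoClass X + isoClass Z :=
  Quotient.sound h.nonempty_iso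

variable [HasZeroObject C]

noncomputable instance isoClassZero : Zero (Quotient (isIsomorphicSetoid C)) where
  zero := Quotient.mk _ (0 : C)

/-- Isomorphism classes of objects form a commutative monoid under direct sum. -/
noncomputable instance isoClassAddCommMonoid :
    AddCommMonoid (Quotient (isIsomorphicSetoid C)) where
  nsmul := nsmulRec
  add_assoc := by
    rintro ⟨X⟩ ⟨Y⟩ ⟨Z⟩
    exact Quotient.sound ⟨biprod.associator X Y Z⟩
  zero_add := by
    rintro ⟨X⟩
    exact Quotient.sound ⟨(isoZeroBiprod (isZero_zero C)).symm⟩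
  add_zero := by
    rintro ⟨X⟩
    exact Quotient.sound ⟨(isoBiprodZero (isZero_zero C)).symm⟩
  add_comm := by
    rintro ⟨X⟩ ⟨Y⟩
    exact Quotient.sound ⟨biprod.braiding X Y⟩

/-- The homomorphism from `F(C)` to the Grothendieck group of the monoid of isomorphism
classes. -/
noncomputable def toGrothendieck :
    FreeAbelianGroup (Quotient (isIsomorphicSetoid C)) →+
      Algebra.GrothendieckAddGroup (Quotient (isIsomorphicSetoid C)) :=
  FreeAbelianGroup.lift Algebra.GrothendieckAddGroup.of

theorem toGrothendieck_fo (X : C) :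
    toGrothendieck (fo X) = Algebra.GrothendieckAddGroup.of (isoClass X) :=
  FreeAbelianGroup.lift_apply_of _ _

theorem ESub_le_ker_toGrothendieck (S : Set C) : ESub S ≤ (toGrothendieck (C := C)).ker := by
  refine (AddSubgroup.closure_le _).2 ?_
  rintro _ ⟨X, Z, Y, -, -, -, h, rfl⟩
  simp [AddMonoidHom.mem_ker, toGrothendieck_fo, h.isoClass_eq]

/-- Objects with the same class in `G(C)` are stably isomorphic. -/
theorem exists_isoClass_add_eq {S : Set C} {X Y : C} (h : fo X - fo Y ∈ ESub S) :
    ∃ Z : C, isoClass Z + isoClass X = isoClass Z + isoClass Y := by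
  have h' := ESub_le_ker_toGrothendieck S h
  rw [AddMonoidHom.mem_ker, map_sub, sub_eq_zero, toGrothendieck_fo, toGrothendieck_fo] at h'
  obtain ⟨⟨c, _⟩, hc⟩ := (AddLocalization.addMonoidOf ⊤).eq_iff_exists.1 h'
  obtain ⟨Z, rfl⟩ := Quotient.exists_rep c
  exact ⟨Z, hc⟩

end

theorem e_inter_f (S : Set B)
    (hiso : ∀ ⦃X Y : B⦄, (X ≅ Y) → X ∈ S → Y ∈ S)
    (hzero : ∃ Z : B, IsZero Z ∧ Z ∈ S)
    (hsum : ∀ ⦃X Z Y : B⦄, IsDirectSumOf Y X Z → X ∈ S → Z ∈ S → Y ∈ S)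
    (hsummand : ∀ X : B, ∃ Y ∈ S, IsSummand X Y) :
    ESub (Set.univ : Set B) ⊓ FSub S = ESub S := by
  refine le_antisymm ?_ (le_inf (ESub_mono (Set.subset_univ S)) (ESub_le_FSub S))
  have : HasBinaryBiproducts B := hasBinaryBiproducts_of_finite_biproducts B
  rintro x ⟨hxE : x ∈ ESub Set.univ, hxF : x ∈ FSub S⟩
  obtain ⟨X, hX, Y, hY, hxy⟩ := exists_sub_mem_ESub hzero hsum hxF
  have hXY : fo X - fo Y ∈ ESub (Set.univ : Set B) := by
    simpa using sub_mem hxE (ESub_mono (Set.subset_univ S) hxy)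
  obtain ⟨Z, hZ⟩ := exists_isoClass_add_eq hXY
  obtain ⟨T, hT, W, hTZW⟩ := hsummand Z
  have hfo : fo (X ⊞ T) = fo (Y ⊞ T) := by
    rw [fo_eq_of_isoClass, fo_eq_of_isoClass, isoClass_biprod, isoClass_biprod,
      hTZW.isoClass_eq, ← add_assoc, ← add_assoc, add_comm (isoClass X), hZ,
      add_comm (isoClass Y)]
  convert sub_mem (add_mem hxy (fo_biprod_sub_mem_ESub hsum hY hT))
    (fo_biprod_sub_mem_ESub hsum hX hT) using 1
  rw [hfo]
  abel
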